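/- Let η, μ, α, β > 0 with β ≤ μ, set s = μ+α+β, and define F : [0,1] → ℝ by F(p) = ((1−p)μ + pβ)/s · ∫₀¹ exp(−ηp·(α²(1−t) + (μ+β)α·(−log t))/s²) · t^{μ/s − 1} dt. Then: (i) if η ≤ η_c^{(d)} := (β/α)(1 + α/(2μ+β)), then p = 0 is the only solution in [0,1) of the fixed-point equation 1 − p = F(p); (ii) if η > η_c^{(d)}, then there is exactly one solution p* of 1 − p = F(p) in (0,1), in addition to the solution p = 0. -/

import Mathlib

open MeasureTheory intervalIntegral

/-- The right-hand side `F(p)` of the fixed-point equation of the DOCS thermodynamic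
limit, with `s = μ+α+β`:
`F(p) = ((1−p)μ + pβ)/s · ∫₀¹ exp(−ηp·(α²(1−t) + (μ+β)α·(−log t))/s²) · t^{μ/s − 1} dt`. -/
noncomputable def docsF (eta mu alpha beta : ℝ) (p : ℝ) : ℝ :=
  ((1 - p) * mu + p * beta) / (mu + alpha + beta) *
    ∫ t in (0:ℝ)..1,
      Real.exp (-(eta * p * (alpha ^ 2 * (1 - t) + (mu + beta) * alpha * (-Real.log t)) /
        (mu + alpha + beta) ^ 2)) * t ^ (mu / (mu + alpha + beta) - 1)

namespace DocsAux

/-- The exponent rate, without the factor `p`. -/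
noncomputable def hh (eta mu alpha beta t : ℝ) : ℝ :=
  eta * (alpha ^ 2 * (1 - t) + (mu + beta) * alpha * (-Real.log t)) / (mu + alpha + beta) ^ 2

lemma one_sub_le_neg_log {t : ℝ} (h0 : 0 < t) : 1 - t ≤ -Real.log t := by
  have := Real.log_le_sub_one_of_pos h0
  linarith

section general
variable {h w : ℝ → ℝ}

lemma intI (hm : Measurable h) (wm : Measurable w)
    (h0 : ∀ t ∈ Set.Ioo (0:ℝ) 1, 0 < h t) (h1 : 0 ≤ h 1)
    (wi : IntervalIntegrable w volume 0 1) {p : ℝ} (hp : 0 ≤ p) :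
    IntervalIntegrable (fun t => Real.exp (-(p * h t)) * w t) volume 0 1 := by
  refine wi.mono_fun (by fun_prop) ?_
  refine (ae_restrict_iff' measurableSet_uIoc).2 (Filter.Eventually.of_forall ?_)
  intro t ht
  rw [Set.uIoc_of_le zero_le_one] at ht
  beta_reduce
  have hn : 0 ≤ h t := by
    rcases eq_or_lt_of_le ht.2 with e | e
    · rw [e]; exact h1
    · exact (h0 t ⟨ht.1, e⟩).le
  rw [norm_mul]
  have : ‖Real.exp (-(p * h t))‖ ≤ 1 := by
    rw [Real.norm_eq_abs, Real.abs_exp, Real.exp_le_one_iff]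
    have := mul_nonneg hp hn
    linarith
  nlinarith [norm_nonneg (w t)]

lemma contI (hm : Measurable h) (wm : Measurable w)
    (h0 : ∀ t ∈ Set.Ioo (0:ℝ) 1, 0 < h t) (h1 : 0 ≤ h 1)
    (wi : IntervalIntegrable w volume 0 1) :
    Continuous (fun p : ℝ => ∫ t in (0:ℝ)..1, Real.exp (-(|p| * h t)) * w t) := by
  refine intervalIntegral.continuous_of_dominated_interval (bound := fun t => ‖w t‖) ?_ ?_ wi.norm ?_
  · intro p; fun_prop
  · intro p
    refine Filter.Eventually.of_forall ?_
    intro t ht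
    rw [Set.uIoc_of_le zero_le_one] at ht
    have hn : 0 ≤ h t := by
      rcases eq_or_lt_of_le ht.2 with e | e
      · rw [e]; exact h1
      · exact (h0 t ⟨ht.1, e⟩).le
    rw [norm_mul]
    have : ‖Real.exp (-(|p| * h t))‖ ≤ 1 := by
      rw [Real.norm_eq_abs, Real.abs_exp, Real.exp_le_one_iff]
      have := mul_nonneg (abs_nonneg p) hn
      linarith
    nlinarith [norm_nonneg (w t)]
  · refine Filter.Eventually.of_forall ?_
    intro t ht
    fun_prop

lemma int_lt {f g : ℝ → ℝ} (hf : IntervalIntegrable f volume 0 1)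
    (hg : IntervalIntegrable g volume 0 1) (hlt : ∀ t ∈ Set.Ioo (0:ℝ) 1, f t < g t) :
    ∫ t in (0:ℝ)..1, f t < ∫ t in (0:ℝ)..1, g t := by
  have := intervalIntegral.intervalIntegral_pos_of_pos_on (hg.sub hf)
    (fun x hx => sub_pos.2 (hlt x hx)) zero_lt_one
  rw [intervalIntegral.integral_sub hg hf] at this
  linarith

/-- strict linear lower bound -/
lemma lowI (hm : Measurable h) (wm : Measurable w)
    (h0 : ∀ t ∈ Set.Ioo (0:ℝ) 1, 0 < h t) (h1 : 0 ≤ h 1)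
    (w0 : ∀ t ∈ Set.Ioo (0:ℝ) 1, 0 < w t)
    (wi : IntervalIntegrable w volume 0 1)
    (hwi : IntervalIntegrable (fun t => h t * w t) volume 0 1) {p : ℝ} (hp : 0 < p) :
    (∫ t in (0:ℝ)..1, w t) - p * (∫ t in (0:ℝ)..1, h t * w t) <
      ∫ t in (0:ℝ)..1, Real.exp (-(p * h t)) * w t := by
  rw [← intervalIntegral.integral_const_mul, ← intervalIntegral.integral_sub wi (hwi.const_mul p)]
  refine int_lt (wi.sub (hwi.const_mul p)) (intI hm wm h0 h1 wi hp.le) ?_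
  intro t ht
  have h2 := mul_pos hp (h0 t ht)
  have h3 := Real.add_one_lt_exp (x := -(p * h t)) (by linarith)
  nlinarith [w0 t ht]

lemma exp_neg_le {x : ℝ} (hx : 0 < x) : Real.exp (-x) < 1 - x + x ^ 2 := by
  have h1 := Real.add_one_lt_exp hx.ne'
  have h2 : Real.exp (-x) * Real.exp x = 1 := by rw [← Real.exp_add]; simp
  have h3 := Real.exp_pos (-x)
  have h4 : Real.exp (-x) * (1 + x) < 1 := by nlinarith
  by_contra hc
  push Not at hc
  have : (1 - x + x^2) * (1 + x) ≤ Real.exp (-x) * (1 + x) := by nlinarith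
  have : 0 < x ^ 3 := by positivity
  nlinarith

lemma upI (hm : Measurable h) (wm : Measurable w)
    (h0 : ∀ t ∈ Set.Ioo (0:ℝ) 1, 0 < h t) (h1 : 0 ≤ h 1)
    (w0 : ∀ t ∈ Set.Ioo (0:ℝ) 1, 0 < w t)
    (wi : IntervalIntegrable w volume 0 1)
    (hwi : IntervalIntegrable (fun t => h t * w t) volume 0 1)
    (hhwi : IntervalIntegrable (fun t => h t ^ 2 * w t) volume 0 1) {p : ℝ} (hp : 0 < p) :
    ∫ t in (0:ℝ)..1, Real.exp (-(p * h t)) * w t <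
    (∫ t in (0:ℝ)..1, w t) - p * (∫ t in (0:ℝ)..1, h t * w t)
      + p ^ 2 * (∫ t in (0:ℝ)..1, h t ^ 2 * w t) := by
  rw [← intervalIntegral.integral_const_mul, ← intervalIntegral.integral_const_mul,
    ← intervalIntegral.integral_sub wi (hwi.const_mul p),
    ← intervalIntegral.integral_add (wi.sub (hwi.const_mul p)) (hhwi.const_mul (p ^ 2))]
  refine int_lt (intI hm wm h0 h1 wi hp.le)
    ((wi.sub (hwi.const_mul p)).add (hhwi.const_mul (p ^ 2))) ?_
  intro t ht
  have h2 := mul_pos hp (h0 t ht)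
  have h3 := mul_lt_mul_of_pos_right (exp_neg_le h2) (w0 t ht)
  nlinarith

lemma exp_conv {l x : ℝ} (hx : 0 < x) (hl : 0 < l) (hl1 : l < 1) :
    Real.exp (-(l * x)) < (1 - l) + l * Real.exp (-x) := by
  have := strictConvexOn_exp.2 (Set.mem_univ 0) (Set.mem_univ (-x)) (by linarith)
    (show 0 < 1 - l by linarith) hl (by ring)
  simpa using this

lemma convI (hm : Measurable h) (wm : Measurable w)
    (h0 : ∀ t ∈ Set.Ioo (0:ℝ) 1, 0 < h t) (h1 : 0 ≤ h 1)
    (w0 : ∀ t ∈ Set.Ioo (0:ℝ) 1, 0 < w t)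
    (wi : IntervalIntegrable w volume 0 1) {p l : ℝ} (hp : 0 < p) (hl : 0 < l) (hl1 : l < 1) :
    ∫ t in (0:ℝ)..1, Real.exp (-((l * p) * h t)) * w t <
    (1 - l) * (∫ t in (0:ℝ)..1, w t) + l * (∫ t in (0:ℝ)..1, Real.exp (-(p * h t)) * w t) := by
  have hi := intI hm wm h0 h1 wi hp.le
  rw [← intervalIntegral.integral_const_mul, ← intervalIntegral.integral_const_mul,
    ← intervalIntegral.integral_add (wi.const_mul _) (hi.const_mul _)]
  refine int_lt (intI hm wm h0 h1 wi (by positivity)) ((wi.const_mul _).add (hi.const_mul _)) ?_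
  intro t ht
  have h2 := mul_pos hp (h0 t ht)
  have h3 := mul_lt_mul_of_pos_right (exp_conv h2 hl hl1) (w0 t ht)
  rw [← mul_assoc] at h3
  nlinarith

lemma leI (hm : Measurable h) (wm : Measurable w)
    (h0 : ∀ t ∈ Set.Ioo (0:ℝ) 1, 0 < h t) (h1 : 0 ≤ h 1)
    (w0 : ∀ t ∈ Set.Ioo (0:ℝ) 1, 0 < w t)
    (wi : IntervalIntegrable w volume 0 1) {p : ℝ} (hp : 0 < p) :
    ∫ t in (0:ℝ)..1, Real.exp (-(p * h t)) * w t < ∫ t in (0:ℝ)..1, w t := by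
  refine int_lt (intI hm wm h0 h1 wi hp.le) wi ?_
  intro t ht
  have h2 := mul_pos hp (h0 t ht)
  have : Real.exp (-(p * h t)) < 1 := by rw [Real.exp_lt_one_iff]; linarith
  nlinarith [w0 t ht]

lemma posI (hm : Measurable h) (wm : Measurable w)
    (h0 : ∀ t ∈ Set.Ioo (0:ℝ) 1, 0 < h t) (h1 : 0 ≤ h 1)
    (w0 : ∀ t ∈ Set.Ioo (0:ℝ) 1, 0 < w t)
    (wi : IntervalIntegrable w volume 0 1) {p : ℝ} (hp : 0 ≤ p) :
    0 < ∫ t in (0:ℝ)..1, Real.exp (-(p * h t)) * w t :=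
  intervalIntegral.intervalIntegral_pos_of_pos_on (intI hm wm h0 h1 wi hp)
    (fun t ht => mul_pos (Real.exp_pos _) (w0 t ht)) zero_lt_one

end general

lemma int_w {a : ℝ} (ha : 0 < a) : IntervalIntegrable (fun t : ℝ => t ^ (a - 1)) volume 0 1 :=
  intervalIntegral.intervalIntegrable_rpow' (by linarith)

lemma val_w {a : ℝ} (ha : 0 < a) : ∫ t in (0:ℝ)..1, t ^ (a - 1) = 1 / a := by
  rw [integral_rpow (Or.inl (by linarith))]
  simp [Real.zero_rpow ha.ne']

lemma neg_log_le {t e : ℝ} (h0 : 0 < t) (he : 0 < e) : -Real.log t ≤ t ^ (-e) / e := by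
  have := Real.log_le_rpow_div (x := t⁻¹) (by positivity) he
  rwa [Real.log_inv, Real.inv_rpow h0.le, ← Real.rpow_neg h0.le] at this

lemma int_log2 {a : ℝ} (ha : 0 < a) :
    IntervalIntegrable (fun t : ℝ => (Real.log t) ^ 2 * t ^ (a - 1)) volume 0 1 := by
  have hi := (int_w (a := a / 2) (by linarith)).const_mul ((4 / a) ^ 2)
  refine hi.mono_fun (by fun_prop) ?_
  refine (ae_restrict_iff' measurableSet_uIoc).2 (Filter.Eventually.of_forall ?_)
  intro t ht
  rw [Set.uIoc_of_le zero_le_one] at ht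
  beta_reduce
  have ht0 := ht.1
  have h1 := neg_log_le ht0 (e := a / 4) (by linarith)
  have h2 : 0 ≤ -Real.log t := by
    have := Real.log_nonpos ht0.le ht.2
    linarith
  have h3 : (Real.log t) ^ 2 ≤ (4 / a) ^ 2 * t ^ (-(a / 2)) := by
    have : (-Real.log t) ^ 2 ≤ (t ^ (-(a / 4)) / (a / 4)) ^ 2 := by gcongr
    have e : (t ^ (-(a / 4))) ^ 2 = t ^ (-(a / 2)) := by
      rw [← Real.rpow_natCast, ← Real.rpow_mul ht0.le]; congr 1; push_cast; ring
    rw [neg_sq, div_pow, e] at this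
    refine this.trans (le_of_eq ?_)
    field_simp
  have e2 : t ^ (a / 2 - 1) = t ^ (-(a / 2)) * t ^ (a - 1) := by
    rw [← Real.rpow_add ht0]; congr 1; ring
  have p1 := Real.rpow_pos_of_pos ht0 (a - 1)
  have p2 := Real.rpow_pos_of_pos ht0 (-(a / 2))
  rw [Real.norm_of_nonneg (by positivity), e2, Real.norm_of_nonneg (by positivity)]
  nlinarith

lemma int_log1 {a : ℝ} (ha : 0 < a) :
    IntervalIntegrable (fun t : ℝ => (-Real.log t) * t ^ (a - 1)) volume 0 1 := by
  have hi := (int_w ha).add (int_log2 ha)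
  refine hi.mono_fun (by fun_prop) ?_
  refine (ae_restrict_iff' measurableSet_uIoc).2 (Filter.Eventually.of_forall ?_)
  intro t ht
  rw [Set.uIoc_of_le zero_le_one] at ht
  beta_reduce
  have ht0 := ht.1
  have h2 : 0 ≤ -Real.log t := by
    have := Real.log_nonpos ht0.le ht.2
    linarith
  have p1 := Real.rpow_pos_of_pos ht0 (a - 1)
  rw [Real.norm_of_nonneg (by positivity), Real.norm_of_nonneg (by positivity)]
  nlinarith [sq_nonneg (Real.log t + 1)]

lemma val_log {a : ℝ} (ha : 0 < a) :
    ∫ t in (0:ℝ)..1, (-Real.log t) * t ^ (a - 1) = 1 / a ^ 2 := by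
  have key := intervalIntegral.integral_eq_sub_of_hasDerivAt_of_tendsto
    (f := fun t : ℝ => t ^ a / a ^ 2 - (Real.log t * t ^ a) / a)
    (f' := fun t : ℝ => (-Real.log t) * t ^ (a - 1)) (a := 0) (b := 1)
    (fa := 0) (fb := 1 / a ^ 2) zero_lt_one ?_ (int_log1 ha) ?_ ?_
  · rw [key]; simp
  · intro t ht
    have h1 := Real.hasDerivAt_rpow_const (x := t) (p := a) (Or.inl ht.1.ne')
    have h2 := Real.hasDerivAt_log ht.1.ne'
    have h3 := (h1.div_const (a ^ 2)).sub ((h2.mul h1).div_const a)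
    refine HasDerivAt.congr_deriv (f := fun t : ℝ => t ^ a / a ^ 2 - (Real.log t * t ^ a) / a) h3 ?_
    have e : t ^ a = t ^ (a - 1) * t := by
      rw [← Real.rpow_add_one ht.1.ne']; congr 1; ring
    rw [e]
    have := ht.1.ne'
    field_simp
    ring
  · have h1 : Filter.Tendsto (fun t : ℝ => t ^ a) (nhdsWithin 0 (Set.Ioi 0)) (nhds 0) := by
      have := (Real.continuousAt_rpow_const 0 a (Or.inr ha.le)).tendsto
      rw [Real.zero_rpow ha.ne'] at this
      exact this.mono_left nhdsWithin_le_nhds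
    have h2 := tendsto_log_mul_rpow_nhdsGT_zero ha
    have := (h1.div_const (a ^ 2)).sub (h2.div_const a)
    simpa using this
  · have hc : ContinuousAt (fun t : ℝ => t ^ a / a ^ 2 - (Real.log t * t ^ a) / a) 1 := by
      have := Real.continuousAt_rpow_const 1 a (Or.inl one_ne_zero)
      have := Real.continuousAt_log (x := 1) one_ne_zero
      fun_prop
    have := hc.tendsto.mono_left (nhdsWithin_le_nhds (s := Set.Iio 1))
    simpa using this

section spec
variable {eta mu alpha beta : ℝ}

lemma hh_meas : Measurable (hh eta mu alpha beta) := by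
  unfold hh; fun_prop

lemma hh_one : hh eta mu alpha beta 1 = 0 := by simp [hh]

lemma hh_pos (heta : 0 < eta) (hmu : 0 < mu) (halpha : 0 < alpha) (hbeta : 0 < beta) :
    ∀ t ∈ Set.Ioo (0:ℝ) 1, 0 < hh eta mu alpha beta t := by
  intro t ht
  have h1 := Real.log_neg ht.1 ht.2
  have h2 : 0 < -Real.log t := by linarith
  have h3 : 0 < 1 - t := by linarith [ht.2]
  unfold hh
  positivity

lemma hh_int {a : ℝ} (ha : 0 < a) :
    IntervalIntegrable (fun t => hh eta mu alpha beta t * t ^ (a - 1)) volume 0 1 := by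
  have h1 := (int_w ha).sub (int_w (a := a + 1) (by linarith))
  have h2 := (h1.const_mul (eta * alpha ^ 2 / (mu + alpha + beta) ^ 2)).add
    ((int_log1 ha).const_mul (eta * ((mu + beta) * alpha) / (mu + alpha + beta) ^ 2))
  refine h2.congr_uIoo ?_
  intro t ht
  rw [Set.uIoo_of_le zero_le_one] at ht
  have e : t ^ (a + 1 - 1) = t ^ (a - 1) * t := by
    rw [← Real.rpow_add_one ht.1.ne']; congr 1; ring
  simp only [hh, e]
  ring

lemma hh_val {a : ℝ} (ha : 0 < a) :
    ∫ t in (0:ℝ)..1, hh eta mu alpha beta t * t ^ (a - 1) =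
      eta / (mu + alpha + beta) ^ 2 *
        (alpha ^ 2 * (1 / a - 1 / (a + 1)) + (mu + beta) * alpha * (1 / a ^ 2)) := by
  have i1 := int_w ha
  have i2 := int_w (a := a + 1) (by linarith)
  have h1 := i1.sub i2
  have i3 := int_log1 ha
  have : ∫ t in (0:ℝ)..1, hh eta mu alpha beta t * t ^ (a - 1) =
      ∫ t in (0:ℝ)..1, ((eta * alpha ^ 2 / (mu + alpha + beta) ^ 2) *
        (t ^ (a - 1) - t ^ (a + 1 - 1)) +
        (eta * ((mu + beta) * alpha) / (mu + alpha + beta) ^ 2) *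
        ((-Real.log t) * t ^ (a - 1))) := by
    refine intervalIntegral.integral_congr_ae (Filter.Eventually.of_forall ?_)
    intro t ht
    rw [Set.uIoc_of_le zero_le_one] at ht
    have e : t ^ (a + 1 - 1) = t ^ (a - 1) * t := by
      rw [← Real.rpow_add_one ht.1.ne']; congr 1; ring
    simp only [hh, e]
    ring
  rw [this, intervalIntegral.integral_add (h1.const_mul _) (i3.const_mul _),
    intervalIntegral.integral_const_mul, intervalIntegral.integral_const_mul,
    intervalIntegral.integral_sub i1 i2, val_w ha, val_w (by linarith), val_log ha]
  ring

lemma hh_int2 (heta : 0 < eta) (hmu : 0 < mu) (halpha : 0 < alpha) (hbeta : 0 < beta)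
    {a : ℝ} (ha : 0 < a) :
    IntervalIntegrable (fun t => hh eta mu alpha beta t ^ 2 * t ^ (a - 1)) volume 0 1 := by
  have hi := (int_log2 ha).const_mul
    ((eta * (alpha ^ 2 + (mu + beta) * alpha) / (mu + alpha + beta) ^ 2) ^ 2)
  have hm := hh_meas (eta := eta) (mu := mu) (alpha := alpha) (beta := beta)
  refine hi.mono_fun (by fun_prop) ?_
  refine (ae_restrict_iff' measurableSet_uIoc).2 (Filter.Eventually.of_forall ?_)
  intro t ht
  rw [Set.uIoc_of_le zero_le_one] at ht
  beta_reduce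
  have ht0 := ht.1
  have h2 : 0 ≤ -Real.log t := by
    have := Real.log_nonpos ht0.le ht.2
    linarith
  have h3 : 0 ≤ 1 - t := by linarith [ht.2]
  have p1 := Real.rpow_pos_of_pos ht0 (a - 1)
  have hn : 0 ≤ hh eta mu alpha beta t := by unfold hh; positivity
  have hl : hh eta mu alpha beta t ≤
      (eta * (alpha ^ 2 + (mu + beta) * alpha) / (mu + alpha + beta) ^ 2) * (-Real.log t) := by
    have h4 := one_sub_le_neg_log ht0
    calc hh eta mu alpha beta t ≤ eta * (alpha ^ 2 * (-Real.log t) +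
          (mu + beta) * alpha * (-Real.log t)) / (mu + alpha + beta) ^ 2 := by
          unfold hh; gcongr
      _ = _ := by ring
  have hsq := pow_le_pow_left₀ hn hl 2
  rw [mul_pow, neg_sq] at hsq
  rw [Real.norm_of_nonneg (by positivity), Real.norm_of_nonneg (by positivity), ← mul_assoc]
  exact mul_le_mul_of_nonneg_right hsq p1.le

lemma docsF_eq (p : ℝ) : docsF eta mu alpha beta p =
    ((1 - p) * mu + p * beta) / (mu + alpha + beta) *
    ∫ t in (0:ℝ)..1, Real.exp (-(p * hh eta mu alpha beta t)) *
      t ^ (mu / (mu + alpha + beta) - 1) := by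
  unfold docsF hh
  congr 1
  refine intervalIntegral.integral_congr ?_
  intro t _
  simp only
  congr 3
  ring

end spec

end DocsAux

open DocsAux in
/-- Let `η, μ, α, β > 0` with `β ≤ μ` and `η_c^{(d)} = (β/α)(1 + α/(2μ+β))`.
(i) If `η ≤ η_c^{(d)}`, then `p = 0` is the only solution in `[0,1)` of `1 − p = F(p)`.
(ii) If `η > η_c^{(d)}`, then `p = 0` is a solution and there is exactly one solution
`p* ∈ (0,1)` of `1 − p = F(p)`. -/
theorem stmt16 (eta mu alpha beta : ℝ)
    (heta : 0 < eta) (hmu : 0 < mu) (halpha : 0 < alpha) (hbeta : 0 < beta)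
    (hbm : beta ≤ mu) :
    (eta ≤ beta / alpha * (1 + alpha / (2 * mu + beta)) →
      ∀ p : ℝ, 0 ≤ p → p < 1 → 1 - p = docsF eta mu alpha beta p → p = 0) ∧
    (beta / alpha * (1 + alpha / (2 * mu + beta)) < eta →
      (1 - (0:ℝ) = docsF eta mu alpha beta 0) ∧
      (∃! p : ℝ, p ∈ Set.Ioo (0:ℝ) 1 ∧ 1 - p = docsF eta mu alpha beta p)) := by

  set s := mu + alpha + beta with hs
  have hs0 : 0 < s := by positivity
  have ha : 0 < mu / s := by positivity
  set h := hh eta mu alpha beta with hh_def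
  set w : ℝ → ℝ := fun t => t ^ (mu / s - 1) with hw
  have hm : Measurable h := hh_meas
  have wm : Measurable w := by fun_prop
  have h0 : ∀ t ∈ Set.Ioo (0:ℝ) 1, 0 < h t := hh_pos heta hmu halpha hbeta
  have h1 : 0 ≤ h 1 := hh_one.ge
  have w0 : ∀ t ∈ Set.Ioo (0:ℝ) 1, 0 < w t := fun t ht => Real.rpow_pos_of_pos ht.1 _
  have wi : IntervalIntegrable w volume 0 1 := int_w ha
  have hwi : IntervalIntegrable (fun t => h t * w t) volume 0 1 := hh_int ha
  have hhwi : IntervalIntegrable (fun t => h t ^ 2 * w t) volume 0 1 :=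
    hh_int2 heta hmu halpha hbeta ha
  have W : ∫ t in (0:ℝ)..1, w t = s / mu := by
    rw [show s / mu = 1 / (mu / s) by field_simp]
    exact val_w ha
  set I : ℝ → ℝ := fun p => ∫ t in (0:ℝ)..1, Real.exp (-(p * h t)) * w t with hI
  have F : ∀ p, docsF eta mu alpha beta p = ((1 - p) * mu + p * beta) / s * I p :=
    fun p => docsF_eq p
  set c := ∫ t in (0:ℝ)..1, h t * w t with hc
  have cval : c * mu / s = eta * alpha * (2 * mu + beta) / (mu * (2 * mu + alpha + beta)) := by
    have := hh_val (eta := eta) (mu := mu) (alpha := alpha) (beta := beta) ha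
    have e : c = _ := this
    rw [e, ← hs]
    have e2 : mu / s + 1 = (2 * mu + alpha + beta) / s := by
      rw [hs]; field_simp; ring
    rw [e2]
    have : (2 * mu + alpha + beta) ≠ 0 := by positivity
    field_simp
    rw [hs]; ring
  have cpos : 0 < c := by
    have : 0 < c * mu / s := by rw [cval]; positivity
    by_contra hcc
    push Not at hcc
    have : c * mu / s ≤ 0 :=
      div_nonpos_of_nonpos_of_nonneg (mul_nonpos_of_nonpos_of_nonneg hcc hmu.le) hs0.le
    linarith
  have thr : beta / alpha * (1 + alpha / (2 * mu + beta)) =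
      beta * (2 * mu + alpha + beta) / (alpha * (2 * mu + beta)) := by
    field_simp; ring
  have hD : 0 < 2 * mu + alpha + beta := by positivity
  have hA : ∀ p : ℝ, 0 ≤ p → p ≤ 1 → 0 < ((1 - p) * mu + p * beta) / s := by
    intro p hp hp1
    refine div_pos ?_ hs0
    rcases eq_or_lt_of_le hp1 with e | e
    · rw [e]; linarith
    · have : 0 < (1 - p) * mu := mul_pos (by linarith) hmu
      have : 0 ≤ p * beta := by positivity
      linarith
  have I0 : I 0 = s / mu := by
    rw [← W]; simp [hI]
  have F0 : 1 - (0:ℝ) = docsF eta mu alpha beta 0 := by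
    rw [F, I0]; field_simp; ring
  rw [thr]
  constructor
  · intro hle p hp hp1 heq
    by_contra hne
    have hp0 : 0 < p := lt_of_le_of_ne hp (Ne.symm hne)
    have hlow : s / mu - p * c < I p := by
      rw [← W]; exact lowI hm wm h0 h1 w0 wi hwi hp0
    rw [F] at heq
    have h2 := mul_lt_mul_of_pos_left hlow (hA p hp hp1.le)
    have h3 : ((1 - p) * mu + p * beta) / s * (s / mu - p * c) =
        1 - p + p * (beta / mu - c * mu / s) + p ^ 2 * c * (mu - beta) / s := by
      field_simp; ring
    have h4 : c * mu / s ≤ beta / mu := by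
      rw [cval, div_le_div_iff₀ (by positivity) hmu]
      rw [le_div_iff₀ (by positivity)] at hle
      nlinarith
    have h5 : 0 ≤ p ^ 2 * c * (mu - beta) / s := by
      have : 0 ≤ mu - beta := by linarith
      positivity
    have h6 : 0 ≤ p * (beta / mu - c * mu / s) := mul_nonneg hp (by linarith)
    linarith
  · intro hlt
    refine ⟨F0, ?_⟩
    have h4 : beta / mu < c * mu / s := by
      rw [cval, div_lt_div_iff₀ hmu (by positivity)]
      rw [div_lt_iff₀ (by positivity)] at hlt
      nlinarith
    have key : ∀ p q : ℝ, 0 < p → p < q → q < 1 → 1 - p = docsF eta mu alpha beta p →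
        1 - q = docsF eta mu alpha beta q → False := by
      intro p q hp hpq hq1 ep eq
      have hq : 0 < q := hp.trans hpq
      have hl0 : 0 < p / q := by positivity
      have hl1 : p / q < 1 := (div_lt_one hq).2 hpq
      obtain ⟨l, hl⟩ : ∃ l, l = p / q := ⟨_, rfl⟩
      rw [← hl] at hl0 hl1
      have hpl : p = l * q := by rw [hl]; field_simp
      subst hpl
      have hconv : I (l * q) < (1 - l) * (s / mu) + l * I q := by
        rw [← W]; exact convI hm wm h0 h1 w0 wi hq hl0 hl1
      have hle : I q < s / mu := by rw [← W]; exact leI hm wm h0 h1 w0 wi hq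
      rw [F] at ep eq
      have h2 := mul_lt_mul_of_pos_left hconv (hA (l * q) hp.le (by linarith))
      have h3 : ((1 - l * q) * mu + l * q * beta) / s * ((1 - l) * (s / mu) + l * I q) =
          (1 - l) + l * (((1 - q) * mu + q * beta) / s * I q)
          - l * (1 - l) * (q * (mu - beta) / s) * (s / mu - I q) := by
        field_simp; ring
      have h5 : 0 ≤ l * (1 - l) * (q * (mu - beta) / s) * (s / mu - I q) := by
        have : 0 ≤ mu - beta := by linarith
        have : 0 ≤ 1 - l := by linarith
        have : 0 ≤ s / mu - I q := by linarith
        positivity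
      rw [h3, ← eq, ← ep] at h2
      nlinarith
    -- existence
    set d := ∫ t in (0:ℝ)..1, h t ^ 2 * w t with hd
    have hd0 : 0 ≤ d := by
      refine intervalIntegral.integral_nonneg zero_le_one ?_
      intro t ht
      have := Real.rpow_nonneg ht.1 (mu / s - 1)
      exact mul_nonneg (sq_nonneg _) this
    obtain ⟨δ, hδ⟩ : ∃ δ, δ = c * mu / s - beta / mu := ⟨_, rfl⟩
    have hδ0 : 0 < δ := by rw [hδ]; linarith
    obtain ⟨K, hK⟩ : ∃ K, K = c * (mu - beta) / s + d * mu / s := ⟨_, rfl⟩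
    have hK0 : 0 ≤ K := by
      have : 0 ≤ mu - beta := by linarith
      rw [hK]; positivity
    obtain ⟨e, he⟩ : ∃ e, e = min (1 / 2) (δ / (K + 1)) := ⟨_, rfl⟩
    have he0 : 0 < e := by rw [he]; positivity
    have he1 : e < 1 := by
      rw [he]; exact lt_of_le_of_lt (min_le_left _ _) (by norm_num)
    have heK : e * K < δ := by
      have : e ≤ δ / (K + 1) := by rw [he]; exact min_le_right _ _
      rw [le_div_iff₀ (by positivity)] at this
      nlinarith
    have hFe : docsF eta mu alpha beta e < 1 - e := by
      have hup : I e < s / mu - e * c + e ^ 2 * d := by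
        rw [← W]; exact upI hm wm h0 h1 w0 wi hwi hhwi he0
      have h2 := mul_lt_mul_of_pos_left hup (hA e he0.le he1.le)
      have h3 : ((1 - e) * mu + e * beta) / s * (s / mu - e * c + e ^ 2 * d) =
          1 - e - e * δ + e * (e * K) - e ^ 3 * (mu - beta) * d / s := by
        rw [hδ, hK]; field_simp; ring
      have h5 : 0 ≤ e ^ 3 * (mu - beta) * d / s := by
        have : 0 ≤ mu - beta := by linarith
        positivity
      have h6 := mul_lt_mul_of_pos_left heK he0
      rw [F]
      linarith
    have hF1 : 1 - (1:ℝ) < docsF eta mu alpha beta 1 := by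
      have := mul_pos (hA 1 zero_le_one le_rfl) (posI hm wm h0 h1 w0 wi zero_le_one)
      rw [F]
      exact lt_of_eq_of_lt (sub_self 1) this
    have hcont : ContinuousOn (fun p => docsF eta mu alpha beta p - (1 - p)) (Set.Icc e 1) := by
      have hcI := contI hm wm h0 h1 wi
      have hC : Continuous (fun p : ℝ => ((1 - p) * mu + p * beta) / s *
          (∫ t in (0:ℝ)..1, Real.exp (-(|p| * h t)) * w t) - (1 - p)) := by
        fun_prop
      refine hC.continuousOn.congr ?_
      intro p hp
      have : 0 ≤ p := he0.le.trans hp.1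
      simp only [F, abs_of_nonneg this, hI]
    have hivt := intermediate_value_Ioo he1.le hcont
    obtain ⟨p, hp, hpe⟩ := hivt (show (0:ℝ) ∈ Set.Ioo _ _ from ⟨by linarith, by linarith⟩)
    have hpe' : 1 - p = docsF eta mu alpha beta p := by
      simp only at hpe; linarith
    refine ⟨p, ⟨⟨he0.trans hp.1, hp.2⟩, hpe'⟩, ?_⟩
    rintro q ⟨hq, hqe⟩
    rcases lt_trichotomy q p with h' | h' | h'
    · exact (key q p hq.1 h' hp.2 hqe hpe').elim
    · exact h'
    · exact (key p q (he0.trans hp.1) h' hq.2 hpe' hqe).elim
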